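/- The differential of the multiplet A•(C•(t)) squares to zero: on T, the operator D̃ := Σ_α λ^α ∂_{θ^α} − Σ_{α,β,μ} λ^α Γ^μ_{αβ} θ^β ∂_{x^μ} + Σ_μ v^μ ∂_{x^μ} + Σ_{α,β,μ} λ^α Γ^μ_{αβ} λ^β ∂_{v^μ} satisfies D̃ ∘ D̃ = 0 (here λ^α·, θ^β· and v^μ· denote the multiplication operators and ∂_{θ^α}, ∂_{v^μ} the contractions). -/

import Mathlib

open scoped TensorProduct

/-- If `p i` and `q i` satisfy the canonical anticommutation relations and the coefficients
`a i`, `b i` commute with one another and with all `p j`, `q j`, then `∑ i, (a i * p i + b i * q i)`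
squares to `∑ i, a i * b i`. -/
theorem sum_mul_self_of_anticommutation {k R ι : Type*} [Field k] [NeZero (2 : k)] [Ring R]
    [Algebra k R] [Fintype ι] [DecidableEq ι] (a b p q : ι → R)
    (haa : ∀ i j, Commute (a i) (a j)) (hab : ∀ i j, Commute (a i) (b j))
    (hbb : ∀ i j, Commute (b i) (b j))
    (hap : ∀ i j, Commute (a i) (p j)) (haq : ∀ i j, Commute (a i) (q j))
    (hbp : ∀ i j, Commute (b i) (p j)) (hbq : ∀ i j, Commute (b i) (q j))
    (hpp : ∀ i j, p i * p j + p j * p i = 0) (hqq : ∀ i j, q i * q j + q j * q i = 0)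
    (hpq : ∀ i j, p i * q j + q j * p i = if i = j then 1 else 0) :
    (∑ i, (a i * p i + b i * q i)) * (∑ i, (a i * p i + b i * q i)) = ∑ i, a i * b i := by
  have mul_swap {x y s t : R} (h : Commute y s) : x * s * (y * t) = x * y * (s * t) := by
    rw [mul_assoc, ← mul_assoc s, ← h.eq]; simp only [mul_assoc]
  have anticomm : ∀ i j, (a i * p i + b i * q i) * (a j * p j + b j * q j)
      + (a j * p j + b j * q j) * (a i * p i + b i * q i)
      = if i = j then (2 : k) • (a i * b i) else 0 := by
    intro i j
    have expand : (a i * p i + b i * q i) * (a j * p j + b j * q j)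
        + (a j * p j + b j * q j) * (a i * p i + b i * q i)
        = a i * a j * (p i * p j + p j * p i) + b i * b j * (q i * q j + q j * q i)
          + a i * b j * (p i * q j + q j * p i) + a j * b i * (p j * q i + q i * p j) := by
      simp only [add_mul, mul_add]
      rw [mul_swap (hap j i), mul_swap (hbp j i), mul_swap (haq j i), mul_swap (hbq j i),
        mul_swap (hap i j), mul_swap (hbp i j), mul_swap (haq i j), mul_swap (hbq i j),
        (haa j i).eq, (hbb j i).eq, (hab i j).eq, (hab j i).eq]
      abel
    rw [expand, hpp, hqq, hpq, hpq]
    by_cases h : i = j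
    · subst h; simp [two_smul]
    · simp [h, Ne.symm h]
  have double : (2 : k) • ((∑ i, (a i * p i + b i * q i)) * (∑ i, (a i * p i + b i * q i)))
      = (2 : k) • ∑ i, a i * b i := by
    rw [two_smul, Finset.sum_mul_sum]
    nth_rewrite 2 [Finset.sum_comm]
    simp only [← Finset.sum_add_distrib, anticomm]
    simp [Finset.smul_sum]
  exact (isUnit_iff_ne_zero.mpr (NeZero.ne (2 : k))).smul_left_cancel.mp double

theorem MvPolynomial.commute_pderiv {σ R : Type*} [CommRing R] (i j : σ) :
    Commute ((MvPolynomial.pderiv i).toLinearMap : Module.End R (MvPolynomial σ R))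
      (MvPolynomial.pderiv j).toLinearMap := by
  classical
  have h : ⁅MvPolynomial.pderiv (R := R) i, MvPolynomial.pderiv (R := R) j⁆ = 0 := by
    refine MvPolynomial.derivation_ext fun l => ?_
    simp [Derivation.commutator_apply, MvPolynomial.pderiv_X, Pi.single_apply, apply_ite]
  refine LinearMap.ext fun f => ?_
  simpa [Derivation.commutator_apply, sub_eq_zero] using DFunLike.congr_fun h f

theorem TensorProduct.commute_rTensor_lTensor {R M N : Type*} [CommSemiring R] [AddCommMonoid M]
    [AddCommMonoid N] [Module R M] [Module R N] (f : Module.End R M) (g : Module.End R N) :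
    Commute (LinearMap.rTensor N f : Module.End R (M ⊗[R] N)) (LinearMap.lTensor M g) :=
  (LinearMap.rTensor_comp_lTensor _ _ _).trans (LinearMap.lTensor_comp_rTensor _ _ _).symm

theorem TensorProduct.commute_rTensor {R M N : Type*} [CommSemiring R] [AddCommMonoid M]
    [AddCommMonoid N] [Module R M] [Module R N] {f g : Module.End R M} (h : Commute f g) :
    Commute (LinearMap.rTensor N f : Module.End R (M ⊗[R] N)) (LinearMap.rTensor N g) := by
  rw [Commute, SemiconjBy, ← LinearMap.rTensor_mul, ← LinearMap.rTensor_mul, h.eq]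

theorem MvPolynomial.commute_mulLeft_X_pderiv {σ R : Type*} [CommRing R] {i j : σ} (h : i ≠ j) :
    Commute (LinearMap.mulLeft R (MvPolynomial.X i) : Module.End R (MvPolynomial σ R))
      (MvPolynomial.pderiv j).toLinearMap := by
  refine LinearMap.ext fun f => ?_
  simp [MvPolynomial.pderiv_X_of_ne h]

section Anticommutators

variable {R M : Type*} [CommRing R] [AddCommGroup M] [Module R M]

theorem ExteriorAlgebra.mulLeft_ι_anticomm (x y : M) :
    (LinearMap.mulLeft R (ExteriorAlgebra.ι R x) * LinearMap.mulLeft R (ExteriorAlgebra.ι R y)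
      + LinearMap.mulLeft R (ExteriorAlgebra.ι R y) * LinearMap.mulLeft R (ExteriorAlgebra.ι R x) :
      Module.End R (ExteriorAlgebra R M)) = 0 := by
  refine LinearMap.ext fun w => ?_
  simp only [LinearMap.add_apply, Module.End.mul_apply, LinearMap.zero_apply,
    LinearMap.mulLeft_apply, ← mul_assoc, ← add_mul]
  rw [ExteriorAlgebra.ι_add_mul_swap, zero_mul]

theorem CliffordAlgebra.contractLeft_anticomm {Q : QuadraticForm R M} (f g : Module.Dual R M) :
    (CliffordAlgebra.contractLeft f * CliffordAlgebra.contractLeft g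
      + CliffordAlgebra.contractLeft g * CliffordAlgebra.contractLeft f :
      Module.End R (CliffordAlgebra Q)) = 0 := by
  refine LinearMap.ext fun w => ?_
  simp only [LinearMap.add_apply, Module.End.mul_apply, LinearMap.zero_apply]
  rw [CliffordAlgebra.contractLeft_comm, neg_add_cancel]

theorem CliffordAlgebra.contractLeft_mulLeft_ι_anticomm {Q : QuadraticForm R M}
    (f : Module.Dual R M) (x : M) :
    (CliffordAlgebra.contractLeft f * LinearMap.mulLeft R (CliffordAlgebra.ι Q x)
      + LinearMap.mulLeft R (CliffordAlgebra.ι Q x) * CliffordAlgebra.contractLeft f :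
      Module.End R (CliffordAlgebra Q)) = f x • 1 := by
  refine LinearMap.ext fun w => ?_
  simp [CliffordAlgebra.contractLeft_ι_mul]

end Anticommutators

/-- The pure spinor differential squares to zero in any algebra in which the even operators `l`, `d`
commute with everything and the odd operators `p`, `q` satisfy the canonical anticommutation
relations. -/
theorem pure_spinor_operator_mul_self {k R ι κ : Type*} [Field k] [NeZero (2 : k)] [Ring R]
    [Algebra k R] [Fintype ι] [DecidableEq ι] [Fintype κ] [DecidableEq κ]
    (Γ : κ → ι → ι → k) (l : ι → R) (d : κ → R) (p q : ι ⊕ κ → R)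
    (hll : ∀ α β, Commute (l α) (l β)) (hld : ∀ α μ, Commute (l α) (d μ))
    (hdd : ∀ μ ν, Commute (d μ) (d ν))
    (hlp : ∀ α i, Commute (l α) (p i)) (hlq : ∀ α i, Commute (l α) (q i))
    (hdp : ∀ μ i, Commute (d μ) (p i)) (hdq : ∀ μ i, Commute (d μ) (q i))
    (hpp : ∀ i j, p i * p j + p j * p i = 0) (hqq : ∀ i j, q i * q j + q j * q i = 0)
    (hpq : ∀ i j, p i * q j + q j * p i = if i = j then 1 else 0)
    (D : R) (hD : D = (∑ α, l α * p (Sum.inl α))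
      - (∑ α, ∑ β, ∑ μ, Γ μ α β • (l α * (q (Sum.inl β) * d μ)))
      + (∑ μ, q (Sum.inr μ) * d μ)
      + (∑ α, ∑ β, ∑ μ, Γ μ α β • (l α * (l β * p (Sum.inr μ))))) :
    D * D = 0 := by
  let a : ι ⊕ κ → R := Sum.elim l fun μ => ∑ α, ∑ β, Γ μ α β • (l α * l β)
  let b : ι ⊕ κ → R := Sum.elim (fun β => -∑ α, ∑ μ, Γ μ α β • (l α * d μ)) d
  have commute_a {x : R} (hl : ∀ α, Commute (l α) x) (i) : Commute (a i) x := by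
    rcases i with α | μ
    · exact hl α
    · exact Commute.sum_left _ _ _ fun α _ => Commute.sum_left _ _ _ fun β _ =>
        ((hl α).mul_left (hl β)).smul_left _
  have commute_b {x : R} (hl : ∀ α, Commute (l α) x) (hd : ∀ μ, Commute (d μ) x)
      (i) : Commute (b i) x := by
    rcases i with β | μ
    · exact (Commute.sum_left _ _ _ fun α _ => Commute.sum_left _ _ _ fun μ _ =>
        ((hl α).mul_left (hd μ)).smul_left _).neg_left
    · exact hd μ
  have hla (α i) : Commute (l α) (a i) := (commute_a (fun β => hll β α) i).symm
  have hlb (α i) : Commute (l α) (b i) :=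
    (commute_b (fun β => hll β α) (fun μ => (hld α μ).symm) i).symm
  have hdb (μ i) : Commute (d μ) (b i) :=
    (commute_b (fun β => hld β μ) (fun ν => hdd ν μ) i).symm
  have sum_eq : D = ∑ i, (a i * p i + b i * q i) := by
    have hθ : ∑ α, ∑ β, ∑ μ, Γ μ α β • (l α * (q (Sum.inl β) * d μ))
        = ∑ β, ∑ α, ∑ μ, Γ μ α β • (l α * (d μ * q (Sum.inl β))) := by
      rw [Finset.sum_comm]
      simp only [(hdq _ _).eq]
    have hv : ∑ α, ∑ β, ∑ μ, Γ μ α β • (l α * (l β * p (Sum.inr μ)))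
        = ∑ μ, ∑ α, ∑ β, Γ μ α β • (l α * (l β * p (Sum.inr μ))) := by
      rw [Finset.sum_comm_cycle]
    rw [hD, hθ, hv]
    simp only [a, b, Fintype.sum_sum_type, Sum.elim_inl, Sum.elim_inr, Finset.sum_add_distrib,
      Finset.sum_mul, neg_mul, smul_mul_assoc, mul_assoc, Finset.sum_neg_distrib, (hdq _ _).eq]
    abel
  have hab : ∑ i, a i * b i = 0 := by
    simp only [a, b, Fintype.sum_sum_type, Sum.elim_inl, Sum.elim_inr, Finset.sum_mul, mul_neg,
      Finset.mul_sum, smul_mul_assoc, mul_smul_comm, Finset.sum_neg_distrib, neg_add_eq_zero]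
    rw [Finset.sum_comm, Finset.sum_comm_cycle]
    refine Finset.sum_congr rfl fun μ _ => Finset.sum_congr rfl fun α _ =>
      Finset.sum_congr rfl fun β _ => ?_
    rw [← mul_assoc, (hll β α).eq]
  rw [sum_eq, ← hab]
  exact sum_mul_self_of_anticommutation (k := k) a b p q (fun i j => commute_a (hla · j) i)
    (fun i j => commute_a (hlb · j) i) (fun i j => commute_b (hlb · j) (hdb · j) i)
    (fun i j => commute_a (hlp · j) i) (fun i j => commute_a (hlq · j) i)
    (fun i j => commute_b (hlp · j) (hdp · j) i) (fun i j => commute_b (hlq · j) (hdq · j) i)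
    hpp hqq hpq

/-- The differential of the multiplet A•(C•(t)) squares to zero: on
T := ℂ[λ, x] ⊗ Λ(θ, v), the operator
D̃ = Σ_α λ^α ∂_{θ^α} − Σ_{α,β,μ} λ^α Γ^μ_{αβ} θ^β ∂_{x^μ}
    + Σ_μ v^μ ∂_{x^μ} + Σ_{α,β,μ} λ^α Γ^μ_{αβ} λ^β ∂_{v^μ}
satisfies D̃ ∘ D̃ = 0.  The even variables λ^α, x^μ generate the polynomial factor
(indexed by `Sum.inl α` and `Sum.inr μ`), and the odd generators θ^α, v^μ generate the
exterior factor (again indexed by `Sum.inl α` and `Sum.inr μ`). -/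
theorem pure_spinor_multiplet_differential_squares_to_zero
    {m n : ℕ} (hm : 0 < m) (hn : 0 < n)
    (Γ : Fin m → Fin n → Fin n → ℂ)
    (hΓ : ∀ μ α β, Γ μ α β = Γ μ β α) :
    let P := MvPolynomial (Fin n ⊕ Fin m) ℂ
    let Ext := ExteriorAlgebra ℂ ((Fin n ⊕ Fin m) → ℂ)
    let T := P ⊗[ℂ] Ext
    -- multiplication by λ^α on the polynomial factor
    let lmul : Fin n → (T →ₗ[ℂ] T) := fun α =>
      LinearMap.rTensor Ext (LinearMap.mulLeft ℂ (MvPolynomial.X (Sum.inl α)))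
    -- ∂/∂x^μ on the polynomial factor
    let Dx : Fin m → (T →ₗ[ℂ] T) := fun μ =>
      LinearMap.rTensor Ext (MvPolynomial.pderiv (Sum.inr μ)).toLinearMap
    -- left exterior multiplication by θ^β and v^μ on the exterior factor
    let θmul : Fin n → (T →ₗ[ℂ] T) := fun β =>
      LinearMap.lTensor P (LinearMap.mulLeft ℂ (ExteriorAlgebra.ι ℂ (Pi.single (Sum.inl β) 1)))
    let vmul : Fin m → (T →ₗ[ℂ] T) := fun μ =>
      LinearMap.lTensor P (LinearMap.mulLeft ℂ (ExteriorAlgebra.ι ℂ (Pi.single (Sum.inr μ) 1)))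
    -- contractions ∂/∂θ^α and ∂/∂v^μ with the dual basis vectors on the exterior factor
    let θder : Fin n → (T →ₗ[ℂ] T) := fun α =>
      LinearMap.lTensor P
        (CliffordAlgebra.contractLeft (Q := (0 : QuadraticForm ℂ ((Fin n ⊕ Fin m) → ℂ)))
          (LinearMap.proj (Sum.inl α)))
    let vder : Fin m → (T →ₗ[ℂ] T) := fun μ =>
      LinearMap.lTensor P
        (CliffordAlgebra.contractLeft (Q := (0 : QuadraticForm ℂ ((Fin n ⊕ Fin m) → ℂ)))
          (LinearMap.proj (Sum.inr μ)))
    let Dtilde : T →ₗ[ℂ] T :=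
      (∑ α, lmul α ∘ₗ θder α)
      - (∑ α, ∑ β, ∑ μ, Γ μ α β • (lmul α ∘ₗ θmul β ∘ₗ Dx μ))
      + (∑ μ, vmul μ ∘ₗ Dx μ)
      + (∑ α, ∑ β, ∑ μ, Γ μ α β • (lmul α ∘ₗ lmul β ∘ₗ vder μ))
    Dtilde ∘ₗ Dtilde = 0 := by
  intro P Ext T lmul Dx θmul vmul θder vder Dtilde
  refine pure_spinor_operator_mul_self (R := Module.End ℂ (MvPolynomial (Fin n ⊕ Fin m) ℂ ⊗[ℂ]
      ExteriorAlgebra ℂ ((Fin n ⊕ Fin m) → ℂ))) Γ lmul Dx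
    (fun i => LinearMap.lTensor P
      (CliffordAlgebra.contractLeft (Q := (0 : QuadraticForm ℂ ((Fin n ⊕ Fin m) → ℂ)))
        (LinearMap.proj i)))
    (fun i => LinearMap.lTensor P
      (LinearMap.mulLeft ℂ (ExteriorAlgebra.ι ℂ (Pi.single i 1))))
    (fun α β => TensorProduct.commute_rTensor (LinearMap.ext fun f => mul_left_comm _ _ _))
    (fun α μ => TensorProduct.commute_rTensor
      (MvPolynomial.commute_mulLeft_X_pderiv Sum.inl_ne_inr))
    (fun μ ν => TensorProduct.commute_rTensor (MvPolynomial.commute_pderiv _ _))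
    (fun _ _ => TensorProduct.commute_rTensor_lTensor _ _)
    (fun _ _ => TensorProduct.commute_rTensor_lTensor _ _)
    (fun _ _ => TensorProduct.commute_rTensor_lTensor _ _)
    (fun _ _ => TensorProduct.commute_rTensor_lTensor _ _)
    (fun i j => ?_) (fun i j => ?_) (fun i j => ?_) Dtilde rfl
  · rw [← LinearMap.lTensor_mul, ← LinearMap.lTensor_mul, ← LinearMap.lTensor_add]
    exact (congrArg _ (CliffordAlgebra.contractLeft_anticomm _ _)).trans (LinearMap.lTensor_zero _)
  · rw [← LinearMap.lTensor_mul, ← LinearMap.lTensor_mul, ← LinearMap.lTensor_add]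
    exact (congrArg _ (ExteriorAlgebra.mulLeft_ι_anticomm _ _)).trans (LinearMap.lTensor_zero _)
  · rw [← LinearMap.lTensor_mul, ← LinearMap.lTensor_mul, ← LinearMap.lTensor_add]
    refine (congrArg _ (CliffordAlgebra.contractLeft_mulLeft_ι_anticomm _ _)).trans ?_
    rw [LinearMap.lTensor_smul]
    simp [Pi.single_apply, Module.End.one_eq_id]
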